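/- arXiv:2001.11579 — 3 statements merged into one kernel-verified Lean document; each statement's English description precedes it below -/
import Mathlib

section
/- Let c₁, c₃, c₅ : ℝ² → ℝ and c₄ : ℝ → ℝ be smooth, and set c₂ = c₄'' (second derivative of c₄). Define the Lagrangian L(a,b,c) = c₁(a,b)·c₄(c) + c₃(a,b)·c + c₅(a,b). Then for every smooth u : ℝ → ℝ and every z ∈ ℝ, the Euler–Lagrange expression EL(z) = L_u − (d/dz)[L_{u'}] + (d²/dz²)[L_{u''}] along u equals u⁗·c₁c₂ + (u''')²·c₁c₂' + 2u''u'''·c₁ᵦc₂ + 2u'u'''·c₁ₐc₂ + (u'')²·(c₁ᵦᵦc₄' + c₃ᵦᵦ) − u''·(c₁ᵦᵦc₄ + c₃ᵦᵦu'' + c₅ᵦᵦ − c₁ₐc₄' − c₃ₐ) + 2u'u''·(c₁ₐᵦc₄' + c₃ₐᵦ) − u'·(c₁ₐᵦc₄ + c₃ₐᵦu'' + c₅ₐᵦ) + (u')²·(c₁ₐₐc₄' + c₃ₐₐ) + c₁ₐc₄ + c₃ₐu'' + c₅ₐ, where subscripts a, b denote partial derivatives of c₁, c₃, c₅ with respect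 to their first and second arguments evaluated at (u(z), u'(z)), c₄, c₄', c₂, c₂' are evaluated at u''(z), and u', u'', u''', u⁗ are the derivatives of u at z. -/
open Real

/-- Partial derivative of a second-order Lagrangian `L(u, u', u'')` with respect to its
first argument `u`. -/
noncomputable def pd1 (L : ℝ × ℝ × ℝ → ℝ) (p : ℝ × ℝ × ℝ) : ℝ :=
  deriv (fun x => L (x, p.2.1, p.2.2)) p.1

/-- Partial derivative with respect to the second argument `u'`. -/
noncomputable def pd2 (L : ℝ × ℝ × ℝ → ℝ) (p : ℝ × ℝ × ℝ) : ℝ :=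
  deriv (fun x => L (p.1, x, p.2.2)) p.2.1

/-- Partial derivative with respect to the third argument `u''`. -/
noncomputable def pd3 (L : ℝ × ℝ × ℝ → ℝ) (p : ℝ × ℝ × ℝ) : ℝ :=
  deriv (fun x => L (p.1, p.2.1, x)) p.2.2

/-- The second-order jet `(u(z), u'(z), u''(z))` of a curve `u`. -/
noncomputable def jet (u : ℝ → ℝ) (z : ℝ) : ℝ × ℝ × ℝ :=
  (u z, deriv u z, deriv (deriv u) z)

/-- The Euler–Lagrange expression `L_u − d/dz[L_{u'}] + d²/dz²[L_{u''}]` along `u`. -/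
noncomputable def eulerLagrange (L : ℝ × ℝ × ℝ → ℝ) (u : ℝ → ℝ) (z : ℝ) : ℝ :=
  pd1 L (jet u z) - deriv (fun t => pd2 L (jet u t)) z
    + deriv (deriv (fun t => pd3 L (jet u t))) z

/-- Partial derivative of a function of two real variables with respect to its
first argument. -/
noncomputable def qd1 (f : ℝ × ℝ → ℝ) (p : ℝ × ℝ) : ℝ :=
  deriv (fun x => f (x, p.2)) p.1

/-- Partial derivative of a function of two real variables with respect to its
second argument. -/
noncomputable def qd2 (f : ℝ × ℝ → ℝ) (p : ℝ × ℝ) : ℝ :=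
  deriv (fun x => f (p.1, x)) p.2

theorem qd1_eq_fderiv {f : ℝ × ℝ → ℝ} (hf : Differentiable ℝ f) :
    qd1 f = fun p => fderiv ℝ f p (1, 0) := by
  funext p
  have h : HasDerivAt (fun x : ℝ => (x, p.2)) ((1 : ℝ), (0 : ℝ)) p.1 :=
    (hasDerivAt_id p.1).prodMk (hasDerivAt_const p.1 p.2)
  exact ((hf p).hasFDerivAt.comp_hasDerivAt p.1 h).deriv

theorem qd2_eq_fderiv {f : ℝ × ℝ → ℝ} (hf : Differentiable ℝ f) :
    qd2 f = fun p => fderiv ℝ f p (0, 1) := by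
  funext p
  have h : HasDerivAt (fun x : ℝ => (p.1, x)) ((0 : ℝ), (1 : ℝ)) p.2 :=
    (hasDerivAt_const p.2 p.1).prodMk (hasDerivAt_id p.2)
  exact ((hf p).hasFDerivAt.comp_hasDerivAt p.2 h).deriv

theorem ContDiff.differentiable_of_smooth {E F : Type*} [NormedAddCommGroup E] [NormedSpace ℝ E]
    [NormedAddCommGroup F] [NormedSpace ℝ F] {f : E → F} (hf : ContDiff ℝ (⊤ : ℕ∞) f) :
    Differentiable ℝ f :=
  hf.differentiable (by simp)

theorem ContDiff.fderiv_smooth {f : ℝ × ℝ → ℝ} (hf : ContDiff ℝ (⊤ : ℕ∞) f) :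
    ContDiff ℝ (⊤ : ℕ∞) (fderiv ℝ f) :=
  hf.fderiv_right (by simp)

theorem ContDiff.deriv_smooth {f : ℝ → ℝ} (hf : ContDiff ℝ (⊤ : ℕ∞) f) :
    ContDiff ℝ (⊤ : ℕ∞) (deriv f) :=
  (contDiff_infty_iff_deriv.1 hf).2

theorem ContDiff.qd1 {f : ℝ × ℝ → ℝ} (hf : ContDiff ℝ (⊤ : ℕ∞) f) :
    ContDiff ℝ (⊤ : ℕ∞) (qd1 f) := by
  rw [qd1_eq_fderiv hf.differentiable_of_smooth]
  exact hf.fderiv_smooth.clm_apply contDiff_const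

theorem ContDiff.qd2 {f : ℝ × ℝ → ℝ} (hf : ContDiff ℝ (⊤ : ℕ∞) f) :
    ContDiff ℝ (⊤ : ℕ∞) (qd2 f) := by
  rw [qd2_eq_fderiv hf.differentiable_of_smooth]
  exact hf.fderiv_smooth.clm_apply contDiff_const

/-- Partial derivatives of a smooth function of two real variables commute. -/
theorem qd2_qd1_comm {f : ℝ × ℝ → ℝ} (hf : ContDiff ℝ (⊤ : ℕ∞) f) :
    qd2 (qd1 f) = qd1 (qd2 f) := by
  rw [qd2_eq_fderiv hf.qd1.differentiable_of_smooth,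
    qd1_eq_fderiv hf.qd2.differentiable_of_smooth,
    qd1_eq_fderiv hf.differentiable_of_smooth, qd2_eq_fderiv hf.differentiable_of_smooth]
  funext p
  have hd : DifferentiableAt ℝ (fderiv ℝ f) p := hf.fderiv_smooth.differentiable_of_smooth p
  have hsymm : IsSymmSndFDerivAt ℝ f p :=
    hf.contDiffAt.isSymmSndFDerivAt (by
      simp only [minSmoothness_of_isRCLikeNormedField]
      exact WithTop.coe_le_coe.2 (le_top : (2 : ℕ∞) ≤ ⊤))
  rw [fderiv_clm_apply hd (differentiableAt_const _),
    fderiv_clm_apply hd (differentiableAt_const _)]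
  simpa using hsymm.eq (0, 1) (1, 0)

/-- Chain rule in terms of the partial derivatives `qd1` and `qd2`. -/
theorem HasDerivAt.comp_qd {f : ℝ × ℝ → ℝ} (hf : ContDiff ℝ (⊤ : ℕ∞) f) {x y : ℝ → ℝ}
    {x' y' z : ℝ} (hx : HasDerivAt x x' z) (hy : HasDerivAt y y' z) :
    HasDerivAt (fun t => f (x t, y t))
      (qd1 f (x z, y z) * x' + qd2 f (x z, y z) * y') z := by
  have hd := hf.differentiable_of_smooth
  have h := (hd (x z, y z)).hasFDerivAt.comp_hasDerivAt z (hx.prodMk hy)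
  refine h.congr_deriv ?_
  have e : ((x', y') : ℝ × ℝ) = x' • ((1 : ℝ), (0 : ℝ)) + y' • ((0 : ℝ), (1 : ℝ)) := by simp
  rw [e, map_add, map_smul, map_smul, qd1_eq_fderiv hd, qd2_eq_fderiv hd]
  simp only [smul_eq_mul]
  ring

theorem ContDiff.hasDerivAt_qd1 {f : ℝ × ℝ → ℝ} (hf : ContDiff ℝ (⊤ : ℕ∞) f) (a b : ℝ) :
    HasDerivAt (fun x => f (x, b)) (_root_.qd1 f (a, b)) a := by
  simpa using (hasDerivAt_id a).comp_qd hf (hasDerivAt_const a b)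

theorem ContDiff.hasDerivAt_qd2 {f : ℝ × ℝ → ℝ} (hf : ContDiff ℝ (⊤ : ℕ∞) f) (a b : ℝ) :
    HasDerivAt (fun y => f (a, y)) (_root_.qd2 f (a, b)) b := by
  simpa using (hasDerivAt_const b a).comp_qd hf (hasDerivAt_id b)

/-- For the generalized family of Lagrangians
`L(u,u',u'') = c₁(u,u') c₄(u'') + c₃(u,u') u'' + c₅(u,u')` with `c₂ = c₄''`,
the Euler–Lagrange expression along a smooth curve `u` equals the paper's generalized
variational fourth-order ODE expression (17). -/
theorem eulerLagrange_general_family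
    (c₁ c₃ c₅ : ℝ × ℝ → ℝ) (c₄ : ℝ → ℝ)
    (hc₁ : ContDiff ℝ (⊤ : ℕ∞) c₁) (hc₃ : ContDiff ℝ (⊤ : ℕ∞) c₃) (hc₅ : ContDiff ℝ (⊤ : ℕ∞) c₅)
    (hc₄ : ContDiff ℝ (⊤ : ℕ∞) c₄)
    (c₂ : ℝ → ℝ) (hc₂ : c₂ = deriv (deriv c₄))
    (L : ℝ × ℝ × ℝ → ℝ)
    (hL : L = fun p => c₁ (p.1, p.2.1) * c₄ p.2.2 + c₃ (p.1, p.2.1) * p.2.2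
      + c₅ (p.1, p.2.1))
    (u : ℝ → ℝ) (hu : ContDiff ℝ (⊤ : ℕ∞) u) (z : ℝ) :
    eulerLagrange L u z =
      (deriv (deriv (deriv (deriv u))) z) * c₁ (u z, deriv u z) * c₂ (deriv (deriv u) z)
      + (deriv (deriv (deriv u)) z) ^ 2 * c₁ (u z, deriv u z) * deriv c₂ (deriv (deriv u) z)
      + 2 * (deriv (deriv u) z) * (deriv (deriv (deriv u)) z)
          * qd2 c₁ (u z, deriv u z) * c₂ (deriv (deriv u) z)
      + 2 * (deriv u z) * (deriv (deriv (deriv u)) z)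
          * qd1 c₁ (u z, deriv u z) * c₂ (deriv (deriv u) z)
      + (deriv (deriv u) z) ^ 2
          * (qd2 (qd2 c₁) (u z, deriv u z) * deriv c₄ (deriv (deriv u) z)
            + qd2 (qd2 c₃) (u z, deriv u z))
      - (deriv (deriv u) z)
          * (qd2 (qd2 c₁) (u z, deriv u z) * c₄ (deriv (deriv u) z)
            + qd2 (qd2 c₃) (u z, deriv u z) * (deriv (deriv u) z)
            + qd2 (qd2 c₅) (u z, deriv u z)
            - qd1 c₁ (u z, deriv u z) * deriv c₄ (deriv (deriv u) z)
            - qd1 c₃ (u z, deriv u z))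
      + 2 * (deriv u z) * (deriv (deriv u) z)
          * (qd1 (qd2 c₁) (u z, deriv u z) * deriv c₄ (deriv (deriv u) z)
            + qd1 (qd2 c₃) (u z, deriv u z))
      - (deriv u z)
          * (qd1 (qd2 c₁) (u z, deriv u z) * c₄ (deriv (deriv u) z)
            + qd1 (qd2 c₃) (u z, deriv u z) * (deriv (deriv u) z)
            + qd1 (qd2 c₅) (u z, deriv u z))
      + (deriv u z) ^ 2
          * (qd1 (qd1 c₁) (u z, deriv u z) * deriv c₄ (deriv (deriv u) z)
            + qd1 (qd1 c₃) (u z, deriv u z))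
      + qd1 c₁ (u z, deriv u z) * c₄ (deriv (deriv u) z)
      + qd1 c₃ (u z, deriv u z) * (deriv (deriv u) z)
      + qd1 c₅ (u z, deriv u z) := by
  subst hc₂ hL
  have hD {g : ℝ → ℝ} (hg : ContDiff ℝ (⊤ : ℕ∞) g) (t : ℝ) : HasDerivAt g (deriv g t) t :=
    (hg.differentiable_of_smooth t).hasDerivAt
  have hu1 := hu.deriv_smooth
  have hu2 := hu1.deriv_smooth
  have hu3 := hu2.deriv_smooth
  have hc₄1 := hc₄.deriv_smooth
  have hc₄2 := hc₄1.deriv_smooth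
  have hq {f : ℝ × ℝ → ℝ} (hf : ContDiff ℝ (⊤ : ℕ∞) f) (t : ℝ) :=
    (hD hu t).comp_qd hf (hD hu1 t)
  have hr {g : ℝ → ℝ} (hg : ContDiff ℝ (⊤ : ℕ∞) g) (t : ℝ) :
      HasDerivAt (fun s => g (deriv (deriv u) s))
        (deriv g (deriv (deriv u) t) * deriv (deriv (deriv u)) t) t :=
    (hD hg _).comp t (hD hu2 t)
  set L : ℝ × ℝ × ℝ → ℝ := fun p => c₁ (p.1, p.2.1) * c₄ p.2.2 + c₃ (p.1, p.2.1) * p.2.2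
    + c₅ (p.1, p.2.1)
  have hL1 (a b c : ℝ) : pd1 L (a, b, c) = qd1 c₁ (a, b) * c₄ c + qd1 c₃ (a, b) * c
      + qd1 c₅ (a, b) :=
    ((((hc₁.hasDerivAt_qd1 a b).mul_const (c₄ c)).add
      ((hc₃.hasDerivAt_qd1 a b).mul_const c)).add (hc₅.hasDerivAt_qd1 a b)).deriv
  have hL2 (a b c : ℝ) : pd2 L (a, b, c) = qd2 c₁ (a, b) * c₄ c + qd2 c₃ (a, b) * c
      + qd2 c₅ (a, b) :=
    ((((hc₁.hasDerivAt_qd2 a b).mul_const (c₄ c)).add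
      ((hc₃.hasDerivAt_qd2 a b).mul_const c)).add (hc₅.hasDerivAt_qd2 a b)).deriv
  have hL3 (a b c : ℝ) : pd3 L (a, b, c) = c₁ (a, b) * deriv c₄ c + c₃ (a, b) := by
    have h := (((hD hc₄ c).const_mul (c₁ (a, b))).add
      ((hasDerivAt_id c).const_mul (c₃ (a, b)))).add_const (c₅ (a, b))
    rw [mul_one] at h
    exact h.deriv
  simp only [eulerLagrange, jet, hL1, hL2, hL3]
  have h2 := ((((hq hc₁.qd2 z).mul (hr hc₄ z)).add ((hq hc₃.qd2 z).mul (hD hu2 z))).add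
    (hq hc₅.qd2 z)).deriv
  have h3 := funext fun t => (((hq hc₁ t).mul (hr hc₄1 t)).add (hq hc₃ t)).deriv
  have h4 := (((((hq hc₁.qd1 z).mul (hD hu1 z)).add ((hq hc₁.qd2 z).mul (hD hu2 z))).mul
      (hr hc₄1 z)).add ((hq hc₁ z).mul ((hr hc₄2 z).mul (hD hu3 z)))).add
    (((hq hc₃.qd1 z).mul (hD hu1 z)).add ((hq hc₃.qd2 z).mul (hD hu2 z))) |>.deriv
  simp only [Pi.add_def, Pi.mul_def] at h2 h3 h4
  rw [h2, h3, h4, qd2_qd1_comm hc₁, qd2_qd1_comm hc₃]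
  ring
end

section
/- Let d₁, d₂, d₃, μ, A be real numbers and ρ > 0, and let u(z) = A·exp(−z²/ρ²). Then the averaged action S = ∫_ℝ [ −(d₁/2)u'(z)² − (μ/2)u(z)²u''(z) + (1/2)(d₂ − d₃u'(z))u''(z)² ] dz is finite and equals S = A²√π·(27√2·d₂ + ρ²(8√3·Aμ − 9√2·d₁)) / (36ρ³). In particular, the value of S does not depend on d₃. -/
open Real MeasureTheory

theorem integrable_pow_mul_exp_neg_mul_sq {b : ℝ} (hb : 0 < b) (n : ℕ) :
    Integrable fun x : ℝ => x ^ n * Real.exp (-b * x ^ 2) := by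
  have hn : (-1 : ℝ) < n := by linarith [n.cast_nonneg (α := ℝ)]
  simpa using integrable_rpow_mul_exp_neg_mul_sq hb hn

theorem hasDerivAt_exp_neg_mul_sq (b x : ℝ) :
    HasDerivAt (fun x : ℝ => Real.exp (-b * x ^ 2))
      (-2 * b * x * Real.exp (-b * x ^ 2)) x := by
  convert ((hasDerivAt_pow 2 x).const_mul (-b)).exp using 1
  norm_num
  ring

theorem integral_mul_exp_neg_mul_sq {b : ℝ} (hb : 0 < b) :
    ∫ x : ℝ, x ^ 1 * Real.exp (-b * x ^ 2) = 0 := by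
  have h := integral_eq_zero_of_hasDerivAt_of_integrable (hasDerivAt_exp_neg_mul_sq b)
    (((integrable_pow_mul_exp_neg_mul_sq hb 1).const_mul (-2 * b)).congr
      (ae_of_all _ fun x => by ring)) (integrable_exp_neg_mul_sq hb)
  have h' : ∫ x : ℝ, -2 * b * (x ^ 1 * Real.exp (-b * x ^ 2)) = 0 := by
    rw [← h]
    congr 1 with x
    ring
  rw [integral_const_mul] at h'
  exact (mul_eq_zero.mp h').resolve_left (by linarith)

theorem integral_pow_add_two_mul_exp_neg_mul_sq {b : ℝ} (hb : 0 < b) (n : ℕ) :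
    ∫ x : ℝ, x ^ (n + 2) * Real.exp (-b * x ^ 2)
      = (n + 1) / (2 * b) * ∫ x : ℝ, x ^ n * Real.exp (-b * x ^ 2) := by
  have hd (x : ℝ) : HasDerivAt (fun x : ℝ => x ^ (n + 1) * Real.exp (-b * x ^ 2))
      ((n + 1) * (x ^ n * Real.exp (-b * x ^ 2))
        - 2 * b * (x ^ (n + 2) * Real.exp (-b * x ^ 2))) x := by
    refine ((hasDerivAt_pow (n + 1) x).mul (hasDerivAt_exp_neg_mul_sq b x)).congr_deriv ?_
    push_cast [Nat.add_sub_cancel]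
    ring
  have h₀ := (integrable_pow_mul_exp_neg_mul_sq hb n).const_mul ((n : ℝ) + 1)
  have h₂ := (integrable_pow_mul_exp_neg_mul_sq hb (n + 2)).const_mul (2 * b)
  have h := integral_eq_zero_of_hasDerivAt_of_integrable hd (h₀.sub h₂)
    (integrable_pow_mul_exp_neg_mul_sq hb (n + 1))
  rw [integral_sub h₀ h₂, integral_const_mul, integral_const_mul] at h
  rw [div_mul_eq_mul_div, eq_div_iff (by positivity)]
  linarith

theorem integrable_quintic_mul_exp_neg_mul_sq {b : ℝ} (hb : 0 < b) (c : Fin 6 → ℝ) :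
    Integrable fun x : ℝ => ∑ i, c i * (x ^ (i : ℕ) * Real.exp (-b * x ^ 2)) :=
  integrable_finsetSum _ fun i _ => (integrable_pow_mul_exp_neg_mul_sq hb i).const_mul (c i)

theorem integral_quintic_mul_exp_neg_mul_sq {b : ℝ} (hb : 0 < b) (c : Fin 6 → ℝ) :
    ∫ x : ℝ, ∑ i, c i * (x ^ (i : ℕ) * Real.exp (-b * x ^ 2))
      = (c 0 + c 2 / (2 * b) + 3 * c 4 / (4 * b ^ 2)) * √(π / b) := by
  have m₀ : ∫ x : ℝ, x ^ 0 * Real.exp (-b * x ^ 2) = √(π / b) := by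
    simpa using integral_gaussian b
  have m₁ := integral_mul_exp_neg_mul_sq hb
  have m₂ := integral_pow_add_two_mul_exp_neg_mul_sq hb 0
  have m₃ := integral_pow_add_two_mul_exp_neg_mul_sq hb 1
  have m₄ := integral_pow_add_two_mul_exp_neg_mul_sq hb 2
  have m₅ := integral_pow_add_two_mul_exp_neg_mul_sq hb 3
  norm_num only at m₂ m₃ m₄ m₅
  rw [integral_finsetSum Finset.univ fun (i : Fin 6) _ =>
    (integrable_pow_mul_exp_neg_mul_sq hb i).const_mul (c i)]
  simp only [integral_const_mul, Fin.sum_univ_six]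
  change c 0 * (∫ x : ℝ, x ^ 0 * Real.exp (-b * x ^ 2))
    + c 1 * (∫ x : ℝ, x ^ 1 * Real.exp (-b * x ^ 2))
    + c 2 * (∫ x : ℝ, x ^ 2 * Real.exp (-b * x ^ 2))
    + c 3 * (∫ x : ℝ, x ^ 3 * Real.exp (-b * x ^ 2))
    + c 4 * (∫ x : ℝ, x ^ 4 * Real.exp (-b * x ^ 2))
    + c 5 * (∫ x : ℝ, x ^ 5 * Real.exp (-b * x ^ 2)) = _
  rw [m₅, m₄, m₃, m₂, m₁, m₀]
  field_simp
  ring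

/-- Substituting the Gaussian trial function `u(z) = A exp(−z²/ρ²)` into the Lagrangian
`L = −(d₁/2)u_z² − (μ/2)u²u_zz + (1/2)(d₂ − d₃u_z)u_zz²` and integrating over ℝ gives a
finite averaged action equal to
`S = A²√π (27√2 d₂ + ρ²(8√3 Aμ − 9√2 d₁)) / (36ρ³)`; in particular `S` does not depend
on `d₃`. -/
theorem averaged_action_gaussian (d₁ d₂ d₃ μ A ρ : ℝ) (hρ : 0 < ρ)
    (u : ℝ → ℝ) (hu : u = fun z => A * Real.exp (-z ^ 2 / ρ ^ 2)) :
    Integrable (fun z : ℝ =>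
      -(d₁ / 2) * (deriv u z) ^ 2 - (μ / 2) * (u z) ^ 2 * (deriv (deriv u) z)
      + (1 / 2) * (d₂ - d₃ * deriv u z) * (deriv (deriv u) z) ^ 2)
    ∧ (∫ z : ℝ,
        (-(d₁ / 2) * (deriv u z) ^ 2 - (μ / 2) * (u z) ^ 2 * (deriv (deriv u) z)
        + (1 / 2) * (d₂ - d₃ * deriv u z) * (deriv (deriv u) z) ^ 2))
      = A ^ 2 * Real.sqrt π
        * (27 * Real.sqrt 2 * d₂ + ρ ^ 2 * (8 * Real.sqrt 3 * A * μ - 9 * Real.sqrt 2 * d₁))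
        / (36 * ρ ^ 3) := by
  obtain ⟨a, ha⟩ : ∃ a : ℝ, a = 1 / ρ ^ 2 := ⟨_, rfl⟩
  have ha0 : 0 < a := ha ▸ by positivity
  have hu' : u = fun z => A * Real.exp (-a * z ^ 2) := by
    rw [hu, ha]
    ext z
    congr 2
    ring
  have hd1 : deriv u = fun z => -2 * a * A * (z * Real.exp (-a * z ^ 2)) := by
    ext z
    rw [hu', ((hasDerivAt_exp_neg_mul_sq a z).const_mul A).deriv]
    ring
  have hd2 : deriv (deriv u)
      = fun z => A * (4 * a ^ 2 * z ^ 2 - 2 * a) * Real.exp (-a * z ^ 2) := by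
    ext z
    have h : HasDerivAt (fun z => z * Real.exp (-a * z ^ 2)) _ z :=
      (hasDerivAt_id' z).mul (hasDerivAt_exp_neg_mul_sq a z)
    rw [hd1, (h.const_mul (-2 * a * A)).deriv]
    ring
  have e2 (z : ℝ) : Real.exp (-(2 * a) * z ^ 2) = Real.exp (-a * z ^ 2) ^ 2 := by
    rw [← Real.exp_nat_mul]
    congr 1
    push_cast
    ring
  have e3 (z : ℝ) : Real.exp (-(3 * a) * z ^ 2) = Real.exp (-a * z ^ 2) ^ 3 := by
    rw [← Real.exp_nat_mul]
    congr 1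
    push_cast
    ring
  let p : Fin 6 → ℝ := ![2 * a ^ 2 * A ^ 2 * d₂, 0,
    -2 * a ^ 2 * A ^ 2 * d₁ - 8 * a ^ 3 * A ^ 2 * d₂, 0, 8 * a ^ 4 * A ^ 2 * d₂, 0]
  let q : Fin 6 → ℝ := ![μ * a * A ^ 3, 4 * a ^ 3 * A ^ 3 * d₃, -2 * μ * a ^ 2 * A ^ 3,
    -16 * a ^ 4 * A ^ 3 * d₃, 0, 16 * a ^ 5 * A ^ 3 * d₃]
  have h2a : 0 < 2 * a := by positivity
  have h3a : 0 < 3 * a := by positivity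
  have hL : (fun z : ℝ =>
      -(d₁ / 2) * (deriv u z) ^ 2 - (μ / 2) * (u z) ^ 2 * (deriv (deriv u) z)
      + (1 / 2) * (d₂ - d₃ * deriv u z) * (deriv (deriv u) z) ^ 2)
      = fun z => (∑ i, p i * (z ^ (i : ℕ) * Real.exp (-(2 * a) * z ^ 2)))
        + ∑ i, q i * (z ^ (i : ℕ) * Real.exp (-(3 * a) * z ^ 2)) := by
    ext z
    rw [hd2, hd1, hu', e2, e3]
    simp [p, q, Fin.sum_univ_succ]
    ring
  have hp := integrable_quintic_mul_exp_neg_mul_sq h2a p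
  have hq := integrable_quintic_mul_exp_neg_mul_sq h3a q
  rw [hL]
  refine ⟨hp.add hq, ?_⟩
  have sqrt_div (k : ℝ) (hk : 0 < k) : √(π / (k * a)) = √π * ρ * √k / k := by
    have : π / (k * a) = π * (ρ / k) ^ 2 * k := by
      rw [ha]
      field_simp
    rw [this, Real.sqrt_mul (by positivity), Real.sqrt_mul pi_pos.le,
      Real.sqrt_sq (by positivity)]
    ring
  rw [integral_add hp hq, integral_quintic_mul_exp_neg_mul_sq h2a,
    integral_quintic_mul_exp_neg_mul_sq h3a, sqrt_div 2 two_pos, sqrt_div 3 three_pos]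
  simp only [p, q, Matrix.cons_val]
  rw [ha]
  field_simp
  ring
end

section
/- Let d₁, d₂, μ be real numbers with μ ≠ 0 and d₁d₂ > 0, and define S : ℝ × (0,∞) → ℝ by S(A, ρ) = A²√π·(27√2·d₂ + ρ²(8√3·Aμ − 9√2·d₁)) / (36ρ³). Then a pair (A, ρ) with A ≠ 0 and ρ > 0 satisfies the stationarity conditions ∂S/∂A(A,ρ) = 0 and ∂S/∂ρ(A,ρ) = 0 if and only if A = 3√6·d₁/(14μ) and ρ = √(21 d₂/d₁). -/
open Real

/-- Derivative of the averaged action with respect to the amplitude. -/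
lemma hasDerivAt_action_amplitude (c P Q R A r : ℝ) :
    HasDerivAt (fun a : ℝ => a ^ 2 * c * (P + r ^ 2 * (Q * a - R)) / (36 * r ^ 3))
      (c * A * (2 * P + r ^ 2 * (3 * Q * A - 2 * R)) / (36 * r ^ 3)) A := by
  have h := ((((hasDerivAt_id' A).fun_pow 2).mul_const c).fun_mul
    (((((hasDerivAt_id' A).const_mul Q).sub_const R).const_mul (r ^ 2)).const_add P)).div_const
      (36 * r ^ 3)
  refine h.congr_deriv ?_
  push_cast
  ring

/-- Derivative of the averaged action with respect to the width. -/
lemma hasDerivAt_action_width (k P K : ℝ) {r : ℝ} (hr : r ≠ 0) :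
    HasDerivAt (fun r : ℝ => k * (P + r ^ 2 * K) / (36 * r ^ 3))
      (-k * (3 * P + r ^ 2 * K) / (36 * r ^ 4)) r := by
  have h := (((((hasDerivAt_id' r).fun_pow 2).mul_const K).const_add P).const_mul k).fun_div
    (((hasDerivAt_id' r).fun_pow 3).const_mul 36) (by positivity)
  refine h.congr_deriv ?_
  push_cast
  field_simp
  ring

/-- The nontrivial critical points of the averaged action
`S(A,ρ) = A²√π (27√2 d₂ + ρ²(8√3 Aμ − 9√2 d₁)) / (36ρ³)` with `A ≠ 0`, `ρ > 0` are
exactly `A = 3√6 d₁/(14μ)` and `ρ = √(21 d₂/d₁)`. -/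
theorem regular_soliton_critical_point (d₁ d₂ μ : ℝ) (hμ : μ ≠ 0) (hd : 0 < d₁ * d₂)
    (S : ℝ → ℝ → ℝ)
    (hS : ∀ A ρ : ℝ, S A ρ = A ^ 2 * Real.sqrt π
      * (27 * Real.sqrt 2 * d₂ + ρ ^ 2 * (8 * Real.sqrt 3 * A * μ - 9 * Real.sqrt 2 * d₁))
      / (36 * ρ ^ 3))
    (A ρ : ℝ) (hA : A ≠ 0) (hρ : 0 < ρ) :
    (deriv (fun a => S a ρ) A = 0 ∧ deriv (fun r => S A r) ρ = 0) ↔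
      (A = 3 * Real.sqrt 6 * d₁ / (14 * μ) ∧ ρ = Real.sqrt (21 * d₂ / d₁)) := by
  have hd₁ : d₁ ≠ 0 := left_ne_zero_of_mul hd.ne'
  have hρ0 : ρ ≠ 0 := hρ.ne'
  have hc : √π ≠ 0 := (Real.sqrt_pos.2 pi_pos).ne'
  have hs : √(2 : ℝ) ≠ 0 := by positivity
  have ht : √(3 : ℝ) ≠ 0 := by positivity
  have ht2 : √(3 : ℝ) ^ 2 = 3 := Real.sq_sqrt (by norm_num)
  have h6 : √(6 : ℝ) = √2 * √3 := by
    rw [← Real.sqrt_mul (by norm_num)]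
    norm_num
  have hSA : deriv (fun a => S a ρ) A = 0 ↔
      54 * √2 * d₂ + ρ ^ 2 * (24 * √3 * A * μ - 18 * √2 * d₁) = 0 := by
    have h := hasDerivAt_action_amplitude √π (27 * √2 * d₂) (8 * √3 * μ) (9 * √2 * d₁) A ρ
    have hf : (fun a => S a ρ) = fun a : ℝ => a ^ 2 * √π *
        (27 * √2 * d₂ + ρ ^ 2 * (8 * √3 * μ * a - 9 * √2 * d₁)) / (36 * ρ ^ 3) := by
      funext a
      rw [hS, mul_right_comm (8 * √3) a μ]
    rw [hf, h.deriv, div_eq_zero_iff, or_iff_left (by positivity), mul_eq_zero,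
      or_iff_right (mul_ne_zero hc hA)]
    ring_nf
  have hSρ : deriv (fun r => S A r) ρ = 0 ↔
      81 * √2 * d₂ + ρ ^ 2 * (8 * √3 * A * μ - 9 * √2 * d₁) = 0 := by
    simp only [hS]
    rw [(hasDerivAt_action_width (A ^ 2 * √π) _ _ hρ0).deriv, div_eq_zero_iff,
      or_iff_left (by positivity), mul_eq_zero,
      or_iff_right (neg_ne_zero.2 (mul_ne_zero (pow_ne_zero 2 hA) hc))]
    ring_nf
  have hq : 0 ≤ 21 * d₂ / d₁ := by
    have : 21 * d₂ / d₁ = 21 * (d₁ * d₂) / d₁ ^ 2 := by field_simp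
    rw [this]
    positivity
  have hwidth : ρ = √(21 * d₂ / d₁) ↔ ρ ^ 2 * d₁ = 21 * d₂ := by
    rw [eq_comm, Real.sqrt_eq_iff_eq_sq hq hρ.le, eq_comm, eq_div_iff hd₁]
  have hamp : A = 3 * √6 * d₁ / (14 * μ) ↔ 14 * √3 * A * μ = 9 * √2 * d₁ := by
    rw [eq_div_iff (by positivity), h6]
    constructor
    · intro h
      linear_combination √3 * h + 3 * √2 * d₁ * ht2
    · intro h
      apply mul_left_cancel₀ ht
      linear_combination h - 3 * √2 * d₁ * ht2
  rw [hSA, hSρ, hwidth, hamp]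
  constructor
  · rintro ⟨h₁, h₂⟩
    constructor
    · apply mul_left_cancel₀ (pow_ne_zero 2 hρ0)
      linear_combination (3 * h₁ - 2 * h₂) / 4
    · apply mul_left_cancel₀ hs
      linear_combination (h₁ - 3 * h₂) / 9
  · rintro ⟨h₁, h₂⟩
    constructor
    · linear_combination 12 / 7 * ρ ^ 2 * h₁ - 18 / 7 * √2 * h₂
    · linear_combination 4 / 7 * ρ ^ 2 * h₁ - 27 / 7 * √2 * h₂
end
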